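/- Let n ≥ 1 and let E, F be Köthe sequence spaces such that E is n-convex with constant 1. Let α ∈ ℂ^ℕ and C ≥ 0. Then the following are equivalent: (a) the pointwise product α·x ∈ F^× and ‖α·x‖_{F^×} ≤ C·‖x‖_{E^n} for all x ∈ E^n; (b) for every β ∈ F and all x_1,…,x_n ∈ E the series ∑_k α(k)·β(k)·x_1(k)⋯x_n(k) converges absolutely and |∑_k α(k)·β(k)·x_1(k)⋯x_n(k)| ≤ C·‖β‖_F·‖x_1‖_E⋯‖x_n‖_E. (This is the isometric identity M(E^n, F^×) = M(F, ℓ_n(𝓛;E)).) -/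

import Mathlib

/-- A Köthe sequence space: a linear subspace of `ℂ^ℕ` with a complete norm such that
`ℓ₁ ⊆ E ⊆ ℓ_∞` with inclusions of norm at most 1, and which is normal. -/
structure KotheSpace : Type where
  Mem : (ℕ → ℂ) → Prop
  nrm : (ℕ → ℂ) → ℝ
  mem_zero : Mem 0
  mem_add : ∀ {x y : ℕ → ℂ}, Mem x → Mem y → Mem (x + y)
  mem_smul : ∀ (c : ℂ) {x : ℕ → ℂ}, Mem x → Mem (c • x)
  nrm_add_le : ∀ {x y : ℕ → ℂ}, Mem x → Mem y → nrm (x + y) ≤ nrm x + nrm y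
  nrm_smul : ∀ (c : ℂ) {x : ℕ → ℂ}, Mem x → nrm (c • x) = ‖c‖ * nrm x
  nrm_eq_zero_iff : ∀ {x : ℕ → ℂ}, Mem x → (nrm x = 0 ↔ x = 0)
  l1_mem : ∀ {x : ℕ → ℂ}, Summable (fun k => ‖x k‖) → Mem x
  nrm_le_l1 : ∀ {x : ℕ → ℂ}, Summable (fun k => ‖x k‖) → nrm x ≤ ∑' k, ‖x k‖
  coord_le_nrm : ∀ {x : ℕ → ℂ}, Mem x → ∀ k, ‖x k‖ ≤ nrm x
  normal_mem : ∀ {x y : ℕ → ℂ}, Mem y → (∀ k, ‖x k‖ ≤ ‖y k‖) → Mem x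
  normal_nrm : ∀ {x y : ℕ → ℂ}, Mem x → Mem y → (∀ k, ‖x k‖ ≤ ‖y k‖) → nrm x ≤ nrm y
  complete : ∀ f : ℕ → ℕ → ℂ, (∀ i, Mem (f i)) →
    (∀ ε : ℝ, 0 < ε → ∃ N, ∀ i, N ≤ i → ∀ j, N ≤ j → nrm (f i - f j) < ε) →
    ∃ g, Mem g ∧ ∀ ε : ℝ, 0 < ε → ∃ N, ∀ i, N ≤ i → nrm (f i - g) < ε

namespace KotheSpace

/-- Membership in the Köthe dual `E^×`. -/
def dualMem (E : KotheSpace) (z : ℕ → ℂ) : Prop :=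
  ∀ x, E.Mem x → Summable fun k => ‖z k * x k‖

/-- The norm of the Köthe dual `E^×`. -/
noncomputable def dualNrm (E : KotheSpace) (z : ℕ → ℂ) : ℝ :=
  sSup {r | ∃ x, E.Mem x ∧ E.nrm x ≤ 1 ∧ r = ∑' k, ‖z k * x k‖}

/-- Membership in the Köthe bidual `E^××`. -/
def bidualMem (E : KotheSpace) (z : ℕ → ℂ) : Prop :=
  ∀ w, E.dualMem w → Summable fun k => ‖z k * w k‖

/-- The norm of the Köthe bidual `E^××`. -/
noncomputable def bidualNrm (E : KotheSpace) (z : ℕ → ℂ) : ℝ :=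
  sSup {r | ∃ w, E.dualMem w ∧ E.dualNrm w ≤ 1 ∧ r = ∑' k, ‖z k * w k‖}

end KotheSpace

namespace KotheSpace

/-- `E` is `n`-convex with constant 1. -/
def NConvex (E : KotheSpace) (n : ℕ) : Prop :=
  ∀ (m : ℕ) (x : Fin m → ℕ → ℂ), (∀ j, E.Mem (x j)) →
    E.Mem (fun k => (Complex.ofReal ((∑ j, ‖x j k‖ ^ n) ^ ((1 : ℝ) / n)))) ∧
    E.nrm (fun k => (Complex.ofReal ((∑ j, ‖x j k‖ ^ n) ^ ((1 : ℝ) / n)))) ≤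
      (∑ j, E.nrm (x j) ^ n) ^ ((1 : ℝ) / n)

/-- Membership in the power `E^n` (for `E` `n`-convex): bounded sequences `x` with
`(|x(k)|^{1/n})_k ∈ E`. -/
def powMem (E : KotheSpace) (n : ℕ) (x : ℕ → ℂ) : Prop :=
  (∃ M : ℝ, ∀ k, ‖x k‖ ≤ M) ∧ E.Mem (fun k => Complex.ofReal (‖x k‖ ^ ((1 : ℝ) / n)))

/-- The norm of the power `E^n`: `‖x‖_{E^n} = ‖(|x(k)|^{1/n})_k‖_E ^ n`. -/
noncomputable def powNrm (E : KotheSpace) (n : ℕ) (x : ℕ → ℂ) : ℝ :=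
  E.nrm (fun k => Complex.ofReal (‖x k‖ ^ ((1 : ℝ) / n))) ^ n

end KotheSpace

open scoped BigOperators

namespace KotheSpace

variable (E : KotheSpace)

theorem nrm_nonneg {x : ℕ → ℂ} (hx : E.Mem x) : 0 ≤ E.nrm x :=
  (norm_nonneg _).trans (E.coord_le_nrm hx 0)

theorem nrm_zero : E.nrm 0 = 0 := (E.nrm_eq_zero_iff E.mem_zero).2 rfl

theorem mem_sum {ι : Type*} (s : Finset ι) {f : ι → ℕ → ℂ} (hf : ∀ i, E.Mem (f i)) :
    E.Mem (∑ i ∈ s, f i) := by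
  classical
  induction s using Finset.induction_on with
  | empty => simpa using E.mem_zero
  | insert a s ha ih => rw [Finset.sum_insert ha]; exact E.mem_add (hf a) ih

theorem nrm_sum_le {ι : Type*} (s : Finset ι) {f : ι → ℕ → ℂ} (hf : ∀ i, E.Mem (f i)) :
    E.nrm (∑ i ∈ s, f i) ≤ ∑ i ∈ s, E.nrm (f i) := by
  classical
  induction s using Finset.induction_on with
  | empty => simp [E.nrm_zero]
  | insert a s ha ih =>
    rw [Finset.sum_insert ha, Finset.sum_insert ha]
    exact (E.nrm_add_le (hf a) (E.mem_sum s hf)).trans (by gcongr)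

theorem mem_sub {x y : ℕ → ℂ} (hx : E.Mem x) (hy : E.Mem y) : E.Mem (x - y) := by
  have h := E.mem_add hx (E.mem_smul (-1) hy)
  rwa [neg_one_smul, ← sub_eq_add_neg] at h

theorem nrm_sub_comm {x y : ℕ → ℂ} (hx : E.Mem x) (hy : E.Mem y) :
    E.nrm (x - y) = E.nrm (y - x) := by
  have h := E.nrm_smul (-1) (E.mem_sub hy hx)
  rwa [neg_one_smul, neg_sub, norm_neg, norm_one, one_mul] at h

/-- The Riesz–Fischer property for geometrically decaying sequences. -/
theorem exists_dominating {x : ℕ → ℕ → ℂ} (hx : ∀ j, E.Mem (x j))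
    (hx1 : ∀ j, E.nrm (x j) ≤ (1 / 2) ^ j) :
    ∃ g, E.Mem g ∧ ∀ j k, ‖x j k‖ ≤ ‖g k‖ := by
  let y : ℕ → ℕ → ℂ := fun j k => (‖x j k‖ : ℂ)
  have hy : ∀ j, E.Mem (y j) := fun j => E.normal_mem (hx j) fun k => by simp [y]
  have hy1 : ∀ j, E.nrm (y j) ≤ (1 / 2) ^ j := fun j =>
    (E.normal_nrm (hy j) (hx j) fun k => by simp [y]).trans (hx1 j)
  let f : ℕ → ℕ → ℂ := fun m => ∑ j ∈ Finset.range m, y j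
  have hf : ∀ m, E.Mem (f m) := fun m => E.mem_sum _ hy
  have hdiff : ∀ i j, i ≤ j → E.nrm (f j - f i) ≤ 2 * (1 / 2) ^ i := by
    intro i j hij
    have h1 : f j - f i = ∑ l ∈ Finset.Ico i j, y l := (Finset.sum_Ico_eq_sub _ hij).symm
    rw [h1]
    refine (E.nrm_sum_le _ hy).trans ((Finset.sum_le_sum fun l _ => hy1 l).trans ?_)
    rw [geom_sum_Ico (by norm_num) hij]
    have : (0 : ℝ) ≤ (1 / 2) ^ j := by positivity
    rw [div_le_iff_of_neg (by norm_num)]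
    linarith
  obtain ⟨g, hg, hlim⟩ := E.complete f hf (by
    intro ε hε
    obtain ⟨N, hN⟩ := exists_pow_lt_of_lt_one (show 0 < ε / 2 by positivity)
      (show (1 / 2 : ℝ) < 1 by norm_num)
    have key : ∀ i j, N ≤ i → i ≤ j → E.nrm (f j - f i) < ε := fun i j hi hij => by
      have : (1 / 2 : ℝ) ^ i ≤ (1 / 2) ^ N :=
        pow_le_pow_of_le_one (by norm_num) (by norm_num) hi
      linarith [hdiff i j hij]
    refine ⟨N, fun i hi j hj => ?_⟩
    rcases le_total i j with h | h
    · rw [E.nrm_sub_comm (hf i) (hf j)]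
      exact key i j hi h
    · exact key j i hj h)
  refine ⟨g, hg, fun j k => ?_⟩
  refine le_of_forall_pos_le_add fun ε hε => ?_
  obtain ⟨N, hN⟩ := hlim ε hε
  set m := max N (j + 1)
  have h1 : ‖(f m - g) k‖ ≤ ε :=
    (E.coord_le_nrm (E.mem_sub (hf m) hg) k).trans (hN m (le_max_left _ _)).le
  have h2 : ‖f m k‖ = ∑ l ∈ Finset.range m, ‖x l k‖ := by
    have : f m k = ((∑ l ∈ Finset.range m, ‖x l k‖ : ℝ) : ℂ) := by
      simp [f, y, Finset.sum_apply]
    rw [this, Complex.norm_real, Real.norm_of_nonneg (Finset.sum_nonneg fun _ _ => norm_nonneg _)]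
  have h3 : ‖x j k‖ ≤ ‖f m k‖ := by
    rw [h2]
    exact Finset.single_le_sum (f := fun l => ‖x l k‖) (fun _ _ => norm_nonneg _)
      (Finset.mem_range.2 (Nat.lt_of_succ_le (le_max_right N (j + 1))))
  have h4 : ‖f m k‖ ≤ ‖(f m - g) k‖ + ‖g k‖ := by
    simpa using norm_add_le ((f m - g) k) (g k)
  linarith

/-- Elements of the Köthe dual are bounded functionals. -/
theorem bddAbove_dual {z : ℕ → ℂ} (hz : E.dualMem z) :
    BddAbove {r | ∃ x, E.Mem x ∧ E.nrm x ≤ 1 ∧ r = ∑' k, ‖z k * x k‖} := by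
  by_contra hb
  rw [not_bddAbove_iff] at hb
  have hb' : ∀ j : ℕ, ∃ x, E.Mem x ∧ E.nrm x ≤ 1 ∧ (4 : ℝ) ^ j < ∑' k, ‖z k * x k‖ := by
    intro j
    obtain ⟨r, ⟨x, hx, hx1, rfl⟩, hr⟩ := hb (4 ^ j)
    exact ⟨x, hx, hx1, hr⟩
  choose x hx hx1 hx2 using hb'
  have hc : ∀ j : ℕ, ‖((1 / 2 : ℂ) ^ j)‖ = (1 / 2 : ℝ) ^ j := fun j => by simp
  obtain ⟨g, hg, hdom⟩ := E.exists_dominating (x := fun j => (1 / 2 : ℂ) ^ j • x j)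
    (fun j => E.mem_smul _ (hx j)) (fun j => by
      rw [E.nrm_smul _ (hx j), hc]
      exact mul_le_of_le_one_right (by positivity) (hx1 j))
  obtain ⟨j, hj⟩ := pow_unbounded_of_one_lt (∑' k, ‖z k * g k‖) (show (1 : ℝ) < 2 by norm_num)
  have h1 : (1 / 2 : ℝ) ^ j * ∑' k, ‖z k * x j k‖ ≤ ∑' k, ‖z k * g k‖ := by
    rw [← tsum_mul_left]
    refine ((hz _ (hx j)).mul_left _).tsum_le_tsum (fun k => ?_) (hz g hg)
    have h := hdom j k
    rw [Pi.smul_apply, smul_eq_mul, norm_mul, hc] at h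
    rw [norm_mul, norm_mul, mul_left_comm]
    gcongr
  have h2 : (2 : ℝ) ^ j = (1 / 2) ^ j * 4 ^ j := by rw [← mul_pow]; norm_num
  have h3 : (1 / 2 : ℝ) ^ j * 4 ^ j < (1 / 2) ^ j * ∑' k, ‖z k * x j k‖ := by
    gcongr
    exact hx2 j
  linarith

theorem tsum_le_dualNrm_mul {z x : ℕ → ℂ} (hz : E.dualMem z) (hx : E.Mem x) :
    ∑' k, ‖z k * x k‖ ≤ E.dualNrm z * E.nrm x := by
  rcases (E.nrm_nonneg hx).eq_or_lt with h0 | hpos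
  · obtain rfl := (E.nrm_eq_zero_iff hx).1 h0.symm
    simp [E.nrm_zero]
  · have hc : ‖((E.nrm x)⁻¹ : ℂ)‖ = (E.nrm x)⁻¹ := by
      simp [abs_of_pos hpos]
    have h : ∑' k, ‖z k * (((E.nrm x)⁻¹ : ℂ) • x) k‖ ≤ E.dualNrm z :=
      le_csSup (E.bddAbove_dual hz) ⟨_, E.mem_smul _ hx, by
        rw [E.nrm_smul _ hx, hc, inv_mul_cancel₀ hpos.ne'], rfl⟩
    have h2 : ∑' k, ‖z k * (((E.nrm x)⁻¹ : ℂ) • x) k‖ =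
        (E.nrm x)⁻¹ * ∑' k, ‖z k * x k‖ := by
      rw [← tsum_mul_left]
      congr 1 with k
      rw [Pi.smul_apply, smul_eq_mul, norm_mul, norm_mul, norm_mul, hc]
      ring
    rwa [h2, inv_mul_le_iff₀ hpos, mul_comm] at h

theorem dualNrm_le {z : ℕ → ℂ} {C : ℝ}
    (h : ∀ x, E.Mem x → E.nrm x ≤ 1 → ∑' k, ‖z k * x k‖ ≤ C) : E.dualNrm z ≤ C := by
  refine csSup_le ⟨_, 0, E.mem_zero, by simp [E.nrm_zero], rfl⟩ ?_
  rintro r ⟨x, hx, hx1, rfl⟩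
  exact h x hx hx1

/-- The arithmetic-geometric mean inequality for a product. -/
theorem prod_le_sum_pow {n : ℕ} (hn : 1 ≤ n) (a : Fin n → ℝ) (ha : ∀ i, 0 ≤ a i) :
    ∏ i, a i ≤ ∑ i, (1 / n : ℝ) * a i ^ n := by
  have hn' : (n : ℝ) ≠ 0 := by positivity
  have h := Real.geom_mean_le_arith_mean_weighted Finset.univ (fun _ : Fin n => (1 / n : ℝ))
    (fun i => a i ^ n) (fun _ _ => by positivity) (by simp [hn'])
    (fun i _ => pow_nonneg (ha i) n)
  refine le_of_eq_of_le (Finset.prod_congr rfl fun i _ => ?_) h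
  rw [one_div, Real.pow_rpow_inv_natCast (ha i) (by omega)]

/-- For an `n`-convex space, products of `n` elements lie in the `n`-th power, contractively. -/
theorem prod_powMem {n : ℕ} (hn : 1 ≤ n) (hE : E.NConvex n) {x : Fin n → ℕ → ℂ}
    (hx : ∀ i, E.Mem (x i)) :
    E.powMem n (fun k => ∏ i, x i k) ∧
      E.powNrm n (fun k => ∏ i, x i k) ≤ ∏ i, E.nrm (x i) := by
  have hn0 : n ≠ 0 := by omega
  have hbdd : ∃ M : ℝ, ∀ k, ‖∏ i, x i k‖ ≤ M := ⟨∏ i, E.nrm (x i), fun k => by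
    rw [norm_prod]
    exact Finset.prod_le_prod (fun _ _ => norm_nonneg _) fun i _ => E.coord_le_nrm (hx i) k⟩
  by_cases hz : ∃ i, E.nrm (x i) = 0
  · obtain ⟨i, hi⟩ := hz
    have hxi := (E.nrm_eq_zero_iff (hx i)).1 hi
    have hp : (fun k => ∏ i, x i k) = 0 := by
      ext k
      exact Finset.prod_eq_zero (Finset.mem_univ i) (by simp [hxi])
    have h0 : (fun k => Complex.ofReal (‖(0 : ℕ → ℂ) k‖ ^ ((1 : ℝ) / n))) = 0 := by
      ext k
      simp [hn0]
    rw [hp]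
    refine ⟨⟨⟨0, by simp⟩, by rw [h0]; exact E.mem_zero⟩, ?_⟩
    rw [powNrm, h0, E.nrm_zero, zero_pow hn0]
    exact Finset.prod_nonneg fun i _ => E.nrm_nonneg (hx i)
  push Not at hz
  have hpos : ∀ i, 0 < E.nrm (x i) := fun i => (E.nrm_nonneg (hx i)).lt_of_ne' (hz i)
  set P := ∏ i, E.nrm (x i) with hP
  have hPpos : 0 < P := Finset.prod_pos fun i _ => hpos i
  let c : Fin n → ℝ := fun i => (1 / n : ℝ) ^ ((1 : ℝ) / n) * (E.nrm (x i))⁻¹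
  have hc : ∀ i, 0 ≤ c i := fun i => by have := hpos i; positivity
  have hcn : ∀ i (t : ℝ), (c i * t) ^ n = (1 / n) * ((E.nrm (x i))⁻¹ * t) ^ n := fun i t => by
    simp only [c]
    rw [mul_assoc, mul_pow, one_div (n : ℝ), Real.rpow_inv_natCast_pow (by positivity) hn0]
  have hw : ∀ i, E.Mem ((c i : ℂ) • x i) := fun i => E.mem_smul _ (hx i)
  obtain ⟨hS, hSn⟩ := hE n (fun i => (c i : ℂ) • x i) hw
  have hnorm : ∀ i, E.nrm ((c i : ℂ) • x i) ^ n = 1 / n := fun i => by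
    rw [E.nrm_smul _ (hx i), Complex.norm_real, Real.norm_of_nonneg (hc i), hcn,
      inv_mul_cancel₀ (hz i), one_pow, mul_one]
  have hone : (∑ i, E.nrm ((c i : ℂ) • x i) ^ n) ^ ((1 : ℝ) / n) = 1 := by
    rw [Finset.sum_congr rfl fun i _ => hnorm i]
    simp [hn0]
  rw [hone] at hSn
  set S : ℕ → ℂ :=
    fun k => Complex.ofReal ((∑ i, ‖((c i : ℂ) • x i) k‖ ^ n) ^ ((1 : ℝ) / n)) with hSdef
  have hle : ∀ k, ‖Complex.ofReal (‖∏ i, x i k‖ ^ ((1 : ℝ) / n))‖ ≤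
      ‖(Complex.ofReal (P ^ ((1 : ℝ) / n)) • S) k‖ := fun k => by
    have hsum : 0 ≤ ∑ i, ‖((c i : ℂ) • x i) k‖ ^ n := by positivity
    rw [Pi.smul_apply, smul_eq_mul, hSdef, ← Complex.ofReal_mul, Complex.norm_real,
      Complex.norm_real, Real.norm_of_nonneg (by positivity), Real.norm_of_nonneg (by positivity),
      ← Real.mul_rpow hPpos.le hsum]
    refine Real.rpow_le_rpow (norm_nonneg _) ?_ (by positivity)
    have h := prod_le_sum_pow hn (fun i => (E.nrm (x i))⁻¹ * ‖x i k‖)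
      (fun i => mul_nonneg (inv_nonneg.2 (hpos i).le) (norm_nonneg _))
    rw [Finset.prod_mul_distrib, Finset.prod_inv_distrib, ← hP, inv_mul_le_iff₀ hPpos,
      ← norm_prod] at h
    refine h.trans_eq ?_
    congr 1
    refine Finset.sum_congr rfl fun i _ => ?_
    rw [Pi.smul_apply, smul_eq_mul, norm_mul, Complex.norm_real, Real.norm_of_nonneg (hc i), hcn]
  have hPS := E.mem_smul (Complex.ofReal (P ^ ((1 : ℝ) / n))) hS
  have hmem := E.normal_mem hPS hle
  refine ⟨⟨hbdd, hmem⟩, ?_⟩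
  have hn1 := E.normal_nrm hmem hPS hle
  rw [E.nrm_smul _ hS, Complex.norm_real, Real.norm_of_nonneg (by positivity)] at hn1
  have hn2 : E.nrm (fun k => Complex.ofReal (‖∏ i, x i k‖ ^ ((1 : ℝ) / n))) ≤
      P ^ ((1 : ℝ) / n) :=
    hn1.trans (mul_le_of_le_one_right (by positivity) hSn)
  refine (pow_le_pow_left₀ (E.nrm_nonneg hmem) hn2 n).trans_eq ?_
  rw [one_div, Real.rpow_inv_natCast_pow hPpos.le hn0]

end KotheSpace

/-- The isometric identity `M(E^n, F^×) = M(F, ℓ_n(𝓛; E))` for `E` `n`-convex with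
constant 1: `α` is a multiplier from `E^n` into `F^×` with bound `C` iff for every
`β ∈ F` the diagonal `n`-linear form associated with `α·β` has norm at most `C·‖β‖_F`. -/
theorem multiplier_pow_dual_iff (n : ℕ) (hn : 1 ≤ n) (E F : KotheSpace) (hE : E.NConvex n)
    (α : ℕ → ℂ) (C : ℝ) (hC : 0 ≤ C) :
    (∀ x : ℕ → ℂ, E.powMem n x →
        F.dualMem (fun k => α k * x k) ∧
        F.dualNrm (fun k => α k * x k) ≤ C * E.powNrm n x) ↔
      (∀ β : ℕ → ℂ, F.Mem β → ∀ x : Fin n → ℕ → ℂ, (∀ i, E.Mem (x i)) →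
        Summable (fun k => ‖α k * β k * ∏ i, x i k‖) ∧
        ‖∑' k, α k * β k * ∏ i, x i k‖ ≤ C * F.nrm β * ∏ i, E.nrm (x i)) := by
  have hn0 : n ≠ 0 := by omega
  constructor
  · intro h β hβ x hx
    obtain ⟨hmem, hnrm⟩ := E.prod_powMem hn hE hx
    obtain ⟨hd, hdn⟩ := h _ hmem
    have heq : ∀ k, α k * β k * ∏ i, x i k = α k * (∏ i, x i k) * β k := fun k => by ring
    simp only [heq]
    have hs := hd β hβ
    refine ⟨hs, (norm_tsum_le_tsum_norm hs).trans ((F.tsum_le_dualNrm_mul hd hβ).trans ?_)⟩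
    have hβ0 := F.nrm_nonneg hβ
    calc _ ≤ (C * ∏ i, E.nrm (x i)) * F.nrm β := by
          gcongr
          exact hdn.trans (by gcongr)
      _ = _ := by ring
  · rintro h x ⟨-, hu⟩
    have hprod : ∀ k, ∏ _i : Fin n, Complex.ofReal (‖x k‖ ^ ((1 : ℝ) / n)) = (‖x k‖ : ℂ) :=
      fun k => by
        rw [Finset.prod_const, Finset.card_univ, Fintype.card_fin, ← Complex.ofReal_pow, one_div,
          Real.rpow_inv_natCast_pow (norm_nonneg _) hn0]
    refine ⟨fun β hβ => ?_, F.dualNrm_le fun β hβ hβ1 => ?_⟩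
    · refine (h β hβ _ fun _ => hu).1.congr fun k => ?_
      rw [hprod]
      simp only [norm_mul, Complex.norm_real, norm_norm]
      ring
    · let γ : ℕ → ℂ := fun k => (starRingEnd ℂ (α k) / ‖α k‖) * ‖β k‖
      have hγle : ∀ k, ‖γ k‖ ≤ ‖β k‖ := fun k => by
        simp only [γ, norm_mul, norm_div, Complex.norm_conj, Complex.norm_real, norm_norm]
        exact mul_le_of_le_one_left (norm_nonneg _) (div_self_le_one _)
      have hγ := F.normal_mem hβ hγle
      have hγ1 : F.nrm γ ≤ 1 := (F.normal_nrm hγ hβ hγle).trans hβ1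
      have hαγ : ∀ k, α k * γ k = ‖α k‖ * ‖β k‖ := fun k => by
        rcases eq_or_ne (α k) 0 with h0 | h0
        · simp [h0]
        · have h1 : (‖α k‖ : ℂ) ≠ 0 := by simpa using h0
          simp only [γ]
          rw [← mul_assoc, ← mul_div_assoc, Complex.mul_conj']
          field_simp
      have hb := (h γ hγ _ fun _ => hu).2
      have hterm : ∀ k, α k * γ k * ∏ _i : Fin n, Complex.ofReal (‖x k‖ ^ ((1 : ℝ) / n)) =
          ((‖α k * x k * β k‖ : ℝ) : ℂ) := fun k => by
        rw [hprod, hαγ, norm_mul, norm_mul]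
        push_cast
        ring
      rw [tsum_congr hterm, ← Complex.ofReal_tsum, Complex.norm_real,
        Real.norm_of_nonneg (tsum_nonneg fun _ => norm_nonneg _), Finset.prod_const,
        Finset.card_univ, Fintype.card_fin] at hb
      refine hb.trans ?_
      have hu0 : 0 ≤ E.powNrm n x := pow_nonneg (E.nrm_nonneg hu) n
      exact mul_le_mul_of_nonneg_right (mul_le_of_le_one_right hC hγ1) hu0
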